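/- arXiv:2405.08133 — 2 statements merged into one kernel-verified Lean document; each statement's English description precedes it below -/
import Mathlib

section
/- Let p, q, λ be positive real numbers, let χ₁ = p/(λq), let χ₂ be a real number, and set M = −2χ₂/p − χ₁²/p² − 1/(λq²); assume M<0. Then there exists θ₀>0 such that, for the circular arc V parametrized by v = q·e^{iθ} with −θ₀ ≤ θ ≤ θ₀, and for any sequences of positive integers (r_n), (s_n) with s_n→∞ and (r_n − λ·s_n) bounded, one has ∫_V v^{−s_n−1}·(1 − (χ₁(v−q)+χ₂(v−q)²)/p)^{−r_n−1} dv = i·q^{−s_n}·√(2π/(−q²·M·r_n)) + o(q^{−s_n}·r_n^{−1/2}) as n→∞. -/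
open Filter Asymptotics

open MeasureTheory Topology in
/-- Laplace's method for integrals of `g ^ r` when `g θ = 1 - a θ² / 2 + o(θ²)` at the origin, with
an amplitude `h` and a bounded frequency perturbation `c`. -/
theorem tendsto_sqrt_mul_integral_pow {g h : ℝ → ℂ} {a θ₀ C : ℝ} (ha : 0 < a) (hθ₀ : 0 < θ₀)
    (hgm : Measurable g) (hhm : Measurable h)
    (hg : (fun θ : ℝ => g θ - (1 - a * θ ^ 2 / 2)) =o[𝓝 0] fun θ : ℝ => θ ^ 2)
    (hh : Tendsto h (𝓝 0) (𝓝 1))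
    (hgb : ∀ θ, |θ| ≤ θ₀ → ‖g θ‖ ≤ Real.exp (-(a / 4) * θ ^ 2))
    (hhb : ∀ θ, |θ| ≤ θ₀ → ‖h θ‖ ≤ C)
    {r : ℕ → ℕ} {c : ℕ → ℝ} {B : ℝ} (hr1 : ∀ n, 1 ≤ r n) (hr : Tendsto r atTop atTop)
    (hc : ∀ n, |c n| ≤ B) :
    Tendsto (fun n => (√(r n : ℝ) : ℂ) *
        ∫ θ in (-θ₀)..θ₀, g θ ^ r n * Complex.exp (c n * θ * Complex.I) * h θ)
      atTop (𝓝 (√(2 * Real.pi / a) : ℂ)) := by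
  set f : ℕ → ℝ → ℂ := fun n θ => g θ ^ r n * Complex.exp (c n * θ * Complex.I) * h θ with hf
  have hrpos : ∀ n, 0 < √(r n : ℝ) := fun n => Real.sqrt_pos.2 (by exact_mod_cast hr1 n)
  have hsqrt : Tendsto (fun k : ℕ => √(k : ℝ)) atTop atTop :=
    Real.tendsto_sqrt_atTop.comp tendsto_natCast_atTop_atTop
  have hscale : ∀ x : ℝ, Tendsto (fun k : ℕ => x / √(k : ℝ)) atTop (𝓝 0) := fun x =>
    hsqrt.const_div_atTop x
  have key : ∀ n, (√(r n : ℝ) : ℂ) * ∫ θ in (-θ₀)..θ₀, f n θ =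
      ∫ x, (Set.Ioc (-θ₀ * √(r n : ℝ)) (θ₀ * √(r n : ℝ))).indicator
        (fun x => f n (x / √(r n : ℝ))) x := by
    intro n
    rw [integral_indicator measurableSet_Ioc, ← intervalIntegral.integral_of_le
      (by nlinarith [hrpos n]), intervalIntegral.integral_comp_div _ (hrpos n).ne',
      mul_div_cancel_right₀ _ (hrpos n).ne', mul_div_cancel_right₀ _ (hrpos n).ne',
      Complex.real_smul]
  have hgauss : ∫ x : ℝ, (Real.exp (-(a / 2) * x ^ 2) : ℂ) = (√(2 * Real.pi / a) : ℂ) := by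
    rw [integral_complex_ofReal, integral_gaussian,
      show Real.pi / (a / 2) = 2 * Real.pi / a by field_simp]
  change Tendsto (fun n => (√(r n : ℝ) : ℂ) * ∫ θ in (-θ₀)..θ₀, f n θ) _ _
  simp_rw [key, ← hgauss]
  refine tendsto_integral_of_dominated_convergence
    (fun x => Real.exp (-(a / 4) * x ^ 2) * C) ?_ ?_ ?_ ?_
  · intro n
    refine (Measurable.indicator ?_ measurableSet_Ioc).aestronglyMeasurable
    simp only [hf]
    fun_prop
  · exact (integrable_exp_neg_mul_sq (by positivity)).mul_const C
  · intro n
    refine Eventually.of_forall fun x => ?_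
    have hC : 0 ≤ C := (norm_nonneg _).trans (hhb 0 (by simpa using hθ₀.le))
    by_cases hx : x ∈ Set.Ioc (-θ₀ * √(r n : ℝ)) (θ₀ * √(r n : ℝ))
    · rw [Set.indicator_of_mem hx]
      have hx' : |x / √(r n : ℝ)| ≤ θ₀ := by
        rw [abs_le, le_div_iff₀ (hrpos n), div_le_iff₀ (hrpos n)]
        exact ⟨hx.1.le, hx.2⟩
      have h1 : ‖Complex.exp (c n * (x / √(r n : ℝ) : ℝ) * Complex.I)‖ = 1 := by
        rw [← Complex.ofReal_mul, Complex.norm_exp_ofReal_mul_I]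
      simp only [hf, norm_mul, norm_pow, h1, mul_one]
      refine mul_le_mul ?_ (hhb _ hx') (norm_nonneg _) (Real.exp_pos _).le
      refine (pow_le_pow_left₀ (norm_nonneg _) (hgb _ hx') _).trans_eq ?_
      rw [← Real.exp_nat_mul, div_pow, Real.sq_sqrt (Nat.cast_nonneg _)]
      have : (r n : ℝ) ≠ 0 := by exact_mod_cast (Nat.pos_of_ne_zero (by have := hr1 n; omega)).ne'
      congr 1
      field_simp
    · rw [Set.indicator_of_notMem hx, norm_zero]
      positivity
  · refine Eventually.of_forall fun x => ?_
    have hmem : ∀ᶠ n in atTop, x ∈ Set.Ioc (-θ₀ * √(r n : ℝ)) (θ₀ * √(r n : ℝ)) := by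
      have h1 : Tendsto (fun n => θ₀ * √(r n : ℝ)) atTop atTop :=
        (hsqrt.comp hr).const_mul_atTop hθ₀
      filter_upwards [h1.eventually_gt_atTop |x|] with n hn
      have := abs_lt.1 hn
      exact ⟨by linarith [this.1], this.2.le⟩
    have hpow : Tendsto (fun n => g (x / √(r n : ℝ)) ^ r n) atTop
        (𝓝 (Real.exp (-(a / 2) * x ^ 2) : ℂ)) := by
      have h0 : Tendsto (fun k : ℕ => g (x / √(k : ℝ)) ^ k) atTop
          (𝓝 (Real.exp (-(a / 2) * x ^ 2) : ℂ)) := by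
        have h2 : Tendsto (fun k : ℕ => (k : ℂ) * (g (x / √(k : ℝ)) - 1)) atTop
            (𝓝 ((-(a / 2) * x ^ 2 : ℝ) : ℂ)) := by
          have h3 : (fun k : ℕ => (k : ℂ) *
              (g (x / √(k : ℝ)) - (1 - a * (x / √(k : ℝ) : ℝ) ^ 2 / 2))) =o[atTop]
              fun _ : ℕ => (1 : ℝ) := by
            have h4 := (isBigO_refl (fun k : ℕ => (k : ℂ)) atTop).mul_isLittleO
              (f₂ := fun k : ℕ => g (x / √(k : ℝ)) - (1 - a * (x / √(k : ℝ) : ℝ) ^ 2 / 2))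
              (g₂ := fun k : ℕ => (((x / √(k : ℝ)) ^ 2 : ℝ) : ℂ))
              ((hg.comp_tendsto (hscale x)).trans_isBigO
                (IsBigO.of_bound 1 (Eventually.of_forall fun k => by simp)))
            refine h4.trans_isBigO (IsBigO.of_bound (x ^ 2) ?_)
            filter_upwards [eventually_gt_atTop 0] with k hk
            have hk' : (k : ℝ) ≠ 0 := by exact_mod_cast hk.ne'
            rw [← Complex.ofReal_natCast, ← Complex.ofReal_mul, Complex.norm_real, div_pow,
              Real.sq_sqrt (Nat.cast_nonneg _), mul_div_cancel₀ _ hk']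
            simp
          have h5 := (isLittleO_one_iff ℝ).1 h3
          have h6 := h5.add_const ((-(a / 2) * x ^ 2 : ℝ) : ℂ)
          rw [zero_add] at h6
          refine h6.congr' ?_
          filter_upwards [eventually_gt_atTop 0] with k hk
          have hk' : (k : ℂ) ≠ 0 := by exact_mod_cast hk.ne'
          have h7 : ((x / √(k : ℝ) : ℝ) : ℂ) ^ 2 = x ^ 2 / k := by
            rw [← Complex.ofReal_pow, div_pow, Real.sq_sqrt (Nat.cast_nonneg _)]
            push_cast
            rfl
          rw [h7]
          push_cast
          field_simp
          ring
        have h8 := Complex.tendsto_one_add_pow_exp_of_tendsto h2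
        rw [← Complex.ofReal_exp] at h8
        simpa using h8
      exact h0.comp hr
    have hphase : Tendsto (fun n => Complex.exp (c n * (x / √(r n : ℝ) : ℝ) * Complex.I)) atTop
        (𝓝 1) := by
      have h1 : Tendsto (fun n => c n * (x / √(r n : ℝ))) atTop (𝓝 0) :=
        bdd_le_mul_tendsto_zero' B (Eventually.of_forall hc) ((hscale x).comp hr)
      have h2 : Tendsto (fun n => Complex.exp ((c n * (x / √(r n : ℝ)) : ℝ) * Complex.I)) atTop
          (𝓝 (Complex.exp ((0 : ℝ) * Complex.I))) :=
        ((by fun_prop : Continuous fun y : ℝ => Complex.exp (y * Complex.I)).tendsto 0).comp h1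
      simpa [mul_assoc] using h2
    have hall := (hpow.mul hphase).mul (hh.comp ((hscale x).comp hr))
    rw [mul_one, mul_one] at hall
    refine hall.congr' ?_
    filter_upwards [hmem] with n hn
    rw [Set.indicator_of_mem hn]
    rfl

open Topology in
/-- Second-order expansion at the origin of `exp (-iθμ) / (1 - μ z - K z²)` with
`z = exp (iθ) - 1`. -/
theorem exp_div_quadratic_isLittleO (μ K : ℝ) :
    (fun θ : ℝ => Complex.exp (-(θ * μ) * Complex.I) *
        (1 - (μ * (Complex.exp (θ * Complex.I) - 1) +
          K * (Complex.exp (θ * Complex.I) - 1) ^ 2))⁻¹ -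
        (1 - ((μ + 2 * K + μ ^ 2 : ℝ) : ℂ) * θ ^ 2 / 2)) =o[𝓝 0] fun θ : ℝ => θ ^ 2 := by
  have hE : ∀ b : ℝ, (fun θ : ℝ => Complex.exp (θ * b * Complex.I) -
      (1 + θ * b * Complex.I - (θ * b) ^ 2 / 2)) =o[𝓝 0] fun θ : ℝ => θ ^ 2 := by
    intro b
    have h1 : Tendsto (fun θ : ℝ => (θ * b * Complex.I : ℂ)) (𝓝 0) (𝓝 0) :=
      Continuous.tendsto' (by fun_prop) _ _ (by simp)
    have h2 := (Complex.exp_sub_sum_range_succ_isLittleO_pow 2).comp_tendsto h1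
    refine (h2.congr_left fun θ => ?_).trans_isBigO
      (IsBigO.of_bound (b ^ 2) (Eventually.of_forall fun θ => ?_))
    · simp [Finset.sum_range_succ, mul_pow]
      ring
    · simp [mul_pow, mul_comm]
  set e : ℝ → ℂ := fun θ => Complex.exp (θ * (1 : ℝ) * Complex.I) -
      (1 + θ * (1 : ℝ) * Complex.I - (θ * (1 : ℝ)) ^ 2 / 2) with he
  set w : ℝ → ℂ := fun θ => 1 - (μ * (Complex.exp (θ * Complex.I) - 1) +
          K * (Complex.exp (θ * Complex.I) - 1) ^ 2) with hw
  have hwc : Continuous w := by fun_prop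
  have hw0 : w 0 = 1 := by simp [hw]
  have hI : Complex.I ^ 2 = -1 := Complex.I_sq
  have hmul : ∀ A : ℝ → ℂ, Continuous A → (fun θ => e θ * A θ) =o[𝓝 0] fun θ : ℝ => θ ^ 2 := by
    intro A hA
    have h1 := (hE 1).mul_isBigO ((hA.tendsto 0).isBigO_one ℝ)
    simp only [mul_one (_ ^ 2 : ℝ)] at h1
    exact h1
  have hsq : ∀ A : ℝ → ℂ, Continuous A → A 0 = 0 →
      (fun θ : ℝ => (θ : ℂ) ^ 2 * A θ) =o[𝓝 0] fun θ : ℝ => θ ^ 2 := by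
    intro A hA hA0
    have h1 : (fun θ : ℝ => (θ : ℂ) ^ 2) =O[𝓝 0] fun θ : ℝ => θ ^ 2 :=
      IsBigO.of_bound 1 (Eventually.of_forall fun θ => by simp)
    simpa using h1.mul_isLittleO ((isLittleO_one_iff ℝ).2 (by simpa [hA0] using hA.tendsto 0))
  have hnum : (fun θ : ℝ => Complex.exp (-(θ * μ) * Complex.I) -
      (1 - ((μ + 2 * K + μ ^ 2 : ℝ) : ℂ) * θ ^ 2 / 2) * w θ) =o[𝓝 0] fun θ : ℝ => θ ^ 2 := by
    have h3 := ((hE (-μ)).add (hmul (fun θ => μ + K * (Complex.exp (θ * Complex.I) - 1 +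
        θ * Complex.I - θ ^ 2 / 2)) (by fun_prop))).add
      (hsq (fun θ => ((μ + 2 * K + μ ^ 2 : ℝ) : ℂ) / 2 * (w θ - 1) +
        K * (-Complex.I * θ + θ ^ 2 / 4)) (by fun_prop) (by simp [hw0]))
    refine h3.congr_left fun θ => ?_
    simp only [he, hw]
    push_cast
    rw [show (θ * -μ * Complex.I : ℂ) = -(θ * μ) * Complex.I by ring, mul_one]
    linear_combination (-K * θ ^ 2 : ℂ) * hI
  have hwinv : Tendsto (fun θ => (w θ)⁻¹) (𝓝 0) (𝓝 1) := by
    simpa [hw0] using (hwc.tendsto 0).inv₀ (by simp [hw0])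
  have h4 := hnum.mul_isBigO (hwinv.isBigO_one ℝ)
  simp only [mul_one] at h4
  refine h4.congr' ?_ EventuallyEq.rfl
  filter_upwards [hwc.continuousAt.eventually_ne (y := 0) (by simp [hw0])] with θ hθ
  rw [sub_mul, mul_inv_cancel_right₀ hθ]

/-- Lemma (v-integral): a Fourier–Laplace type contour integral over an arc of the
circle of radius `q`. -/
theorem stmt3
    (p q lam χ₂ : ℝ) (hp : 0 < p) (hq : 0 < q) (hlam : 0 < lam)
    (χ₁ M : ℝ) (hχ₁ : χ₁ = p / (lam * q))
    (hM : M = -2 * χ₂ / p - χ₁ ^ 2 / p ^ 2 - 1 / (lam * q ^ 2))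
    (hMneg : M < 0) :
    ∃ θ₀ : ℝ, 0 < θ₀ ∧
      ∀ r s : ℕ → ℕ, (∀ n, 1 ≤ r n) → (∀ n, 1 ≤ s n) →
        Tendsto s atTop atTop →
        (∃ B : ℝ, ∀ n, |(r n : ℝ) - lam * (s n : ℝ)| ≤ B) →
        (fun n : ℕ =>
          (∫ θ in (-θ₀)..θ₀,
            ((q : ℂ) * Complex.exp (θ * Complex.I)) ^ (-(s n : ℤ) - 1) *
              (1 - ((χ₁ : ℂ) * ((q : ℂ) * Complex.exp (θ * Complex.I) - (q : ℂ)) +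
                    (χ₂ : ℂ) * ((q : ℂ) * Complex.exp (θ * Complex.I) - (q : ℂ)) ^ 2) /
                  (p : ℂ)) ^ (-(r n : ℤ) - 1) *
              (Complex.I * (q : ℂ) * Complex.exp (θ * Complex.I))) -
          Complex.I * ((q ^ (-(s n : ℝ)) * Real.sqrt (2 * Real.pi / (-(q ^ 2 * M * (r n : ℝ)))) : ℝ) : ℂ))
        =o[atTop] (fun n : ℕ => q ^ (-(s n : ℝ)) * (r n : ℝ) ^ (-(1 : ℝ)/2)) := by
  set μ : ℝ := lam⁻¹ with hμ
  set K : ℝ := χ₂ * q ^ 2 / p with hK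
  set a : ℝ := μ + 2 * K + μ ^ 2 with ha_def
  have haM : a = -(q ^ 2 * M) := by
    rw [ha_def, hM, hχ₁, hK, hμ]
    field_simp
    ring
  have ha : 0 < a := by
    rw [haM]
    nlinarith [pow_pos hq 2]
  set w : ℝ → ℂ := fun θ => 1 - (μ * (Complex.exp (θ * Complex.I) - 1) +
          K * (Complex.exp (θ * Complex.I) - 1) ^ 2) with hw
  have hwc : Continuous w := by fun_prop
  have hw0 : w 0 = 1 := by simp [hw]
  have hwinv : Tendsto (fun θ => (w θ)⁻¹) (nhds 0) (nhds 1) := by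
    simpa [hw0] using (hwc.tendsto 0).inv₀ (by simp [hw0])
  set g : ℝ → ℂ := fun θ => Complex.exp (-(θ * μ) * Complex.I) * (w θ)⁻¹ with hg
  have hgo : (fun θ : ℝ => g θ - (1 - a * θ ^ 2 / 2)) =o[nhds 0] fun θ : ℝ => θ ^ 2 :=
    exp_div_quadratic_isLittleO μ K
  have hgm : Measurable g := by
    have := hwc.measurable
    fun_prop
  have hev : ∀ᶠ θ : ℝ in nhds 0, ‖g θ‖ ≤ Real.exp (-(a / 4) * θ ^ 2) ∧ ‖(w θ)⁻¹‖ ≤ 2 ∧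
      w θ ≠ 0 := by
    have hsmall : ∀ᶠ θ : ℝ in nhds 0, a * θ ^ 2 / 2 < 1 :=
      (Continuous.tendsto' (by fun_prop) _ _ (by simp) :
        Tendsto (fun θ : ℝ => a * θ ^ 2 / 2) (nhds 0) (nhds 0)).eventually_lt_const one_pos
    filter_upwards [hgo.def (show 0 < a / 4 by positivity), hsmall,
      hwinv.norm.eventually_lt_const (show ‖(1 : ℂ)‖ < 2 by norm_num),
      hwc.continuousAt.eventually_ne (y := 0) (by simp [hw0])] with θ h1 h2 h3 h4
    refine ⟨?_, h3.le, h4⟩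
    have h5 : ‖(1 - a * θ ^ 2 / 2 : ℂ)‖ = 1 - a * θ ^ 2 / 2 := by
      rw [show (1 - a * θ ^ 2 / 2 : ℂ) = ((1 - a * θ ^ 2 / 2 : ℝ) : ℂ) by push_cast; rfl,
        Complex.norm_real, Real.norm_of_nonneg (by linarith)]
    have h6 := norm_le_norm_add_norm_sub (1 - a * θ ^ 2 / 2 : ℂ) (g θ)
    rw [h5] at h6
    rw [norm_sub_rev, Real.norm_of_nonneg (sq_nonneg θ)] at h1
    have h7 := Real.add_one_le_exp (-(a / 4) * θ ^ 2)
    linarith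
  obtain ⟨ε, hε, hball⟩ := Metric.eventually_nhds_iff.1 hev
  have hloc : ∀ θ : ℝ, |θ| ≤ ε / 2 → ‖g θ‖ ≤ Real.exp (-(a / 4) * θ ^ 2) ∧ ‖(w θ)⁻¹‖ ≤ 2 ∧
      w θ ≠ 0 := fun θ hθ => hball (by rw [Real.dist_0_eq_abs]; linarith)
  refine ⟨ε / 2, half_pos hε, fun r s hr1 _ hs ⟨B, hB⟩ => ?_⟩
  have hr : Tendsto r atTop atTop := by
    rw [← tendsto_natCast_atTop_iff (R := ℝ)]
    have h1 : Tendsto (fun n => lam * (s n : ℝ) - B) atTop atTop :=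
      tendsto_atTop_add_const_right _ _
        ((tendsto_natCast_atTop_atTop.comp hs).const_mul_atTop hlam)
    exact tendsto_atTop_mono (fun n => by linarith [(abs_le.1 (hB n)).1]) h1
  have hc : ∀ n, |(r n : ℝ) * μ - s n| ≤ B * μ := by
    intro n
    have h1 : (r n : ℝ) * μ - s n = (r n - lam * s n) * μ := by
      rw [hμ]
      field_simp
    have hμ0 : 0 < μ := inv_pos.2 hlam
    rw [h1, abs_mul, abs_of_pos hμ0]
    exact mul_le_mul_of_nonneg_right (hB n) hμ0.le
  have hlim := tendsto_sqrt_mul_integral_pow (h := fun θ => (w θ)⁻¹) ha (half_pos hε) hgm hwc.measurable.inv hgo hwinv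
    (fun θ hθ => (hloc θ hθ).1) (fun θ hθ => (hloc θ hθ).2.1) hr1 hr hc
  have hlim0 := hlim.sub_const (Real.sqrt (2 * Real.pi / a) : ℂ)
  rw [sub_self] at hlim0
  have hlo := (isBigO_refl (fun n : ℕ => q ^ (-(s n : ℝ)) * (r n : ℝ) ^ (-(1 : ℝ) / 2))
    atTop).mul_isLittleO ((isLittleO_one_iff ℝ).2 hlim0).norm_left
  simp only [mul_one] at hlo
  refine hlo.norm_left.congr_left (fun n => ?_) |>.of_norm_left
  have hrp : (0 : ℝ) < r n := by exact_mod_cast hr1 n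
  have hqc : (q : ℂ) ≠ 0 := by exact_mod_cast hq.ne'
  have hint : ∫ θ in (-(ε / 2))..(ε / 2),
      ((q : ℂ) * Complex.exp (θ * Complex.I)) ^ (-(s n : ℤ) - 1) *
        (1 - ((χ₁ : ℂ) * ((q : ℂ) * Complex.exp (θ * Complex.I) - (q : ℂ)) +
              (χ₂ : ℂ) * ((q : ℂ) * Complex.exp (θ * Complex.I) - (q : ℂ)) ^ 2) /
            (p : ℂ)) ^ (-(r n : ℤ) - 1) *
        (Complex.I * (q : ℂ) * Complex.exp (θ * Complex.I)) =
      Complex.I * (q ^ (-(s n : ℝ)) : ℝ) * ∫ θ in (-(ε / 2))..(ε / 2),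
        g θ ^ r n * Complex.exp (((r n : ℝ) * μ - s n : ℝ) * θ * Complex.I) * (w θ)⁻¹ := by
    rw [← intervalIntegral.integral_const_mul]
    refine intervalIntegral.integral_congr fun θ hθ => ?_
    rw [Set.uIcc_of_le (by linarith)] at hθ
    have hwθ : w θ ≠ 0 := (hloc θ (abs_le.2 hθ)).2.2
    have hpc : (p : ℂ) ≠ 0 := by exact_mod_cast hp.ne'
    have hlc : (lam : ℂ) ≠ 0 := by exact_mod_cast hlam.ne'
    have hbase : 1 - ((χ₁ : ℂ) * ((q : ℂ) * Complex.exp (θ * Complex.I) - (q : ℂ)) +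
          (χ₂ : ℂ) * ((q : ℂ) * Complex.exp (θ * Complex.I) - (q : ℂ)) ^ 2) / (p : ℂ) = w θ := by
      simp only [hw, hμ, hK, hχ₁]
      push_cast
      field_simp
    have hexp : Complex.exp (-(θ * μ) * Complex.I) ^ r n *
        Complex.exp (((r n : ℝ) * μ - s n : ℝ) * θ * Complex.I) =
        (Complex.exp (θ * Complex.I) ^ s n)⁻¹ := by
      rw [← Complex.exp_nat_mul, ← Complex.exp_nat_mul, ← Complex.exp_neg, ← Complex.exp_add]
      congr 1
      push_cast
      ring
    have hz : Complex.exp (θ * Complex.I) ≠ 0 := Complex.exp_ne_zero _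
    have hzpow : ∀ (z : ℂ) (k : ℕ), z ^ (-(k : ℤ) - 1) = (z ^ k)⁻¹ * z⁻¹ := by
      intro z k
      rw [show (-(k : ℤ) - 1) = -((k + 1 : ℕ) : ℤ) by push_cast; ring, zpow_neg, zpow_natCast,
        pow_succ, mul_inv]
    simp only [hbase, hg]
    rw [hzpow, hzpow, mul_pow (Complex.exp _), inv_pow, mul_right_comm (Complex.exp _ ^ _), hexp,
      Real.rpow_neg hq.le, Real.rpow_natCast, mul_pow]
    push_cast
    field_simp
  have hsq : (r n : ℝ) ^ (-(1 : ℝ) / 2) * Real.sqrt (r n) = 1 := by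
    rw [Real.sqrt_eq_rpow, ← Real.rpow_add hrp]
    norm_num
  have hsqc : (((r n : ℝ) ^ (-(1 : ℝ) / 2) : ℝ) : ℂ) * (Real.sqrt (r n) : ℂ) = 1 := by
    exact_mod_cast hsq
  have hmain : Real.sqrt (2 * Real.pi / (-(q ^ 2 * M * (r n : ℝ)))) =
      (r n : ℝ) ^ (-(1 : ℝ) / 2) * Real.sqrt (2 * Real.pi / a) := by
    rw [show -(q ^ 2 * M * (r n : ℝ)) = a * r n by rw [haM]; ring, ← div_div,
      Real.sqrt_div (by positivity), div_eq_iff (Real.sqrt_pos.2 hrp).ne', mul_right_comm, hsq,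
      one_mul]
  rw [hint, hmain]
  set J := ∫ θ in (-(ε / 2))..(ε / 2),
    g θ ^ r n * Complex.exp (((r n : ℝ) * μ - s n : ℝ) * θ * Complex.I) * (w θ)⁻¹
  have hfac : Complex.I * (q ^ (-(s n : ℝ)) : ℝ) * J - Complex.I *
      ((q ^ (-(s n : ℝ)) * ((r n : ℝ) ^ (-(1 : ℝ) / 2) * Real.sqrt (2 * Real.pi / a)) : ℝ) : ℂ) =
      Complex.I * ((q ^ (-(s n : ℝ)) * (r n : ℝ) ^ (-(1 : ℝ) / 2) : ℝ) : ℂ) *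
        ((Real.sqrt (r n) : ℂ) * J - (Real.sqrt (2 * Real.pi / a) : ℂ)) := by
    push_cast
    linear_combination (-Complex.I * (q ^ (-(s n : ℝ)) : ℝ) * J) * hsqc
  rw [hfac]
  simp only [norm_mul, norm_norm, Complex.norm_I, one_mul, Complex.norm_real]
end

section
/- Let ℓ>1 be a real number, and set p = (1−1/ℓ)² and q = 1/(ℓ−1)². Then for all real v, w with 0 ≤ v < 1 and 0 ≤ w < 1, one has (1 + vp − (wq)(vp))² − 4vp ≠ 0. (Hence the zero set of H(z,t) = (1+z−tz)² − 4z contains no point coordinate-wise strictly smaller than (p,q) along the box [0,p]×[0,q], so the critical point (p,q) is minimal.) -/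
/-- Minimality of the critical point `(p,q) = ((1-1/ℓ)², 1/(ℓ-1)²)` of
`H(z,t) = (1+z-tz)² - 4z`: no coordinate-wise strictly smaller point of the box
`[0,p]×[0,q]` lies on the zero set of `H`. -/
theorem stmt16 (ℓ : ℝ) (hℓ : 1 < ℓ) (p q : ℝ)
    (hpdef : p = (1 - 1/ℓ) ^ 2) (hqdef : q = 1 / (ℓ - 1) ^ 2) :
    ∀ v w : ℝ, 0 ≤ v → v < 1 → 0 ≤ w → w < 1 →
      (1 + v * p - (w * q) * (v * p)) ^ 2 - 4 * (v * p) ≠ 0 := by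
  intro v w hv hv1 hw hw1 h
  have hℓ0 : 0 < ℓ := by linarith
  have hℓ1 : ℓ - 1 ≠ 0 := by linarith
  obtain ⟨b, hb⟩ : ∃ b, b = 1 / ℓ := ⟨_, rfl⟩
  have hb0 : 0 < b := hb ▸ by positivity
  have hb1 : b < 1 := by rw [hb, div_lt_one hℓ0]; exact hℓ
  have hqp : q * p = b ^ 2 := by
    rw [hpdef, hqdef, hb]
    field_simp
  rw [← hb] at hpdef
  obtain ⟨s, hs0, hs⟩ : ∃ s : ℝ, 0 ≤ s ∧ v = s ^ 2 :=
    ⟨√v, Real.sqrt_nonneg v, (Real.sq_sqrt hv).symm⟩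
  have hs1 : s < 1 := by nlinarith
  have hwv : w * v * b ^ 2 < b ^ 2 := by
    have : w * v < 1 := by nlinarith
    nlinarith [pow_pos hb0 2]
  -- `H` factors as a difference of squares once `v * p` is written as a square.
  have hfac : ((1 - s * (1 - b)) ^ 2 - w * v * b ^ 2) *
      ((1 + s * (1 - b)) ^ 2 - w * v * b ^ 2) = 0 := by
    rw [← h, show (w * q) * (v * p) = w * v * (q * p) by ring, hqp, hpdef, hs]
    ring
  have hsa : 0 ≤ s * (1 - b) := mul_nonneg hs0 (by linarith)
  have hsb : s * (1 - b) < 1 - b := by nlinarith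
  have h₁ : b ^ 2 < (1 - s * (1 - b)) ^ 2 := by nlinarith
  have h₂ : b ^ 2 < (1 + s * (1 - b)) ^ 2 := by nlinarith
  exact (mul_pos (by linarith) (by linarith)).ne' hfac
end
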